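/- arXiv:math/9906164 — 2 statements merged into one kernel-verified Lean document; each statement's English description precedes it below -/
import Mathlib

section
/- Let P = (p₁, p₂, …) and Q = (q₁, q₂, …) be sequences of nonzero integers such that q₁⋯q_i divides p₁⋯p_i for every i. Let c be an integer and let d be a positive integer each of whose prime factors divides p_i for infinitely many i. Then there exists a continuous group homomorphism h : Σ_P → Σ_Q such that h(π_P(s)) = π_Q((c/d)·s) for all s ∈ ℝ; that is, c/d is a proper P → Q multiplier. -/
noncomputable section

/-- The `1`-solenoid determined by a sequence `P` of integers: the inverse limit of
circles `ℝ/ℤ` where the `j`-th bonding map is multiplication by `P j`, realized as a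
closed subgroup of the countable product of circles. -/
def Sol1 (P : ℕ → ℤ) : AddSubgroup (ℕ → AddCircle (1 : ℝ)) where
  carrier := {x | ∀ j, P j • x (j + 1) = x j}
  zero_mem' := by
    intro j
    simp
  add_mem' := by
    intro a b ha hb j
    simp only [Pi.add_apply, smul_add, ha j, hb j]
  neg_mem' := by
    intro a ha j
    simp only [Pi.neg_apply, smul_neg, ha j]

/-- The sequence `t, t/p₁, t/(p₁p₂), …` of real numbers. -/
def sol1PiVec (P : ℕ → ℤ) (t : ℝ) : ℕ → ℝ
  | 0 => t
  | j + 1 => sol1PiVec P t j / (P j : ℝ)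

/-- The canonical homomorphism `π_P : ℝ → Σ_P`,
`π_P t = (t, t/p₁, t/(p₁p₂), …) (mod 1)`. -/
def sol1Pi (P : ℕ → ℤ) (hP : ∀ j, P j ≠ 0) (t : ℝ) : Sol1 P :=
  ⟨fun j => (sol1PiVec P t j : AddCircle (1 : ℝ)), by
    intro j
    have h2 : (P j : ℝ) ≠ 0 := by exact_mod_cast hP j
    show P j • ((sol1PiVec P t j / (P j : ℝ) : ℝ) : AddCircle (1 : ℝ))
        = ((sol1PiVec P t j : ℝ) : AddCircle (1 : ℝ))
    calc P j • ((sol1PiVec P t j / (P j : ℝ) : ℝ) : AddCircle (1 : ℝ))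
        = ((P j • (sol1PiVec P t j / (P j : ℝ)) : ℝ) : AddCircle (1 : ℝ)) := by norm_cast
      _ = ((sol1PiVec P t j : ℝ) : AddCircle (1 : ℝ)) := by
          rw [zsmul_eq_mul, mul_div_cancel₀ _ h2]⟩

/-- Two integer multiples of coordinates of a point of the solenoid agree as soon as the
corresponding multiples of the partial products do. -/
theorem Sol1.zsmul_apply_eq {P : ℕ → ℤ} (hP : ∀ j, P j ≠ 0) {x : ℕ → AddCircle (1 : ℝ)}
    (hx : x ∈ Sol1 P) {m n : ℕ} {a b : ℤ}
    (h : a * ∏ j ∈ Finset.range n, P j = b * ∏ j ∈ Finset.range m, P j) :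
    a • x m = b • x n := by
  have descend : ∀ m n : ℕ, m ≤ n → (∏ j ∈ Finset.Ico m n, P j) • x n = x m := by
    intro m n hmn
    induction n, hmn using Nat.le_induction with
    | base => simp
    | succ n hmn ih => rw [Finset.prod_Ico_succ_top hmn, mul_smul, hx n, ih]
  have of_le : ∀ (m n : ℕ) (a b : ℤ), m ≤ n →
      a * ∏ j ∈ Finset.range n, P j = b * ∏ j ∈ Finset.range m, P j → a • x m = b • x n := by
    intro m n a b hmn h
    have hm : ∏ j ∈ Finset.range m, P j ≠ 0 := Finset.prod_ne_zero_iff.mpr fun j _ => hP j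
    rw [← Finset.prod_range_mul_prod_Ico _ hmn] at h
    have hb : b = a * ∏ j ∈ Finset.Ico m n, P j := mul_right_cancel₀ hm (by rw [← h]; ring)
    rw [hb, mul_smul, descend m n hmn]
  rcases le_total m n with hmn | hnm
  · exact of_le m n a b hmn h
  · exact (of_le n m b a hnm h.symm).symm

theorem sol1PiVec_eq_div_prod (P : ℕ → ℤ) (t : ℝ) (j : ℕ) :
    sol1PiVec P t j = t / ((∏ k ∈ Finset.range j, P k : ℤ) : ℝ) := by
  induction j with
  | zero => simp [sol1PiVec]
  | succ j ih => rw [sol1PiVec, ih, Finset.prod_range_succ, Int.cast_mul, div_div]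

/-- If every prime factor of `d` divides infinitely many terms of `P`, then every partial
product of `P` can be continued so as to pick up a factor `d`. -/
theorem exists_mul_prod_range_dvd (P : ℕ → ℤ) {d : ℕ} (hd : d ≠ 0)
    (hdP : ∀ p : ℕ, p.Prime → p ∣ d → {i : ℕ | (p : ℤ) ∣ P i}.Infinite) (i : ℕ) :
    ∃ n, (d : ℤ) * ∏ j ∈ Finset.range i, P j ∣ ∏ j ∈ Finset.range n, P j := by
  induction d using induction_on_primes with
  | zero => exact absurd rfl hd
  | one => exact ⟨i, by simp⟩
  | prime_mul p a hp ih =>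
    obtain ⟨n, hn⟩ := ih (right_ne_zero_of_mul hd) fun q hq hqa => hdP q hq (hqa.mul_left p)
    obtain ⟨k, hk, hnk⟩ := (hdP p hp (dvd_mul_right p a)).exists_gt n
    have hnk' : ∏ j ∈ Finset.range n, P j ∣ ∏ j ∈ Finset.range k, P j :=
      Finset.prod_dvd_prod_of_subset _ _ _ (Finset.range_subset_range.mpr hnk.le)
    refine ⟨k + 1, ?_⟩
    rw [Finset.prod_range_succ, mul_comm _ (P k), Nat.cast_mul, mul_assoc]
    exact mul_dvd_mul hk (hn.trans hnk')

/-- If `q₁⋯q_i` divides `p₁⋯p_i` for every `i`, `c` is an integer and `d` a positive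
integer all of whose prime factors divide infinitely many terms of `P`, then `c/d`
is a proper `P → Q` multiplier: there is a continuous group homomorphism
`h : Σ_P → Σ_Q` with `h (π_P s) = π_Q ((c/d) s)` for all `s ∈ ℝ`. -/
theorem sol1_proper_multiplier_exists (P Q : ℕ → ℤ)
    (hP : ∀ j, P j ≠ 0) (hQ : ∀ j, Q j ≠ 0)
    (hdvd : ∀ i : ℕ, (∏ j ∈ Finset.range i, Q j) ∣ ∏ j ∈ Finset.range i, P j)
    (c : ℤ) (d : ℕ) (hd : 0 < d)
    (hdP : ∀ p : ℕ, p.Prime → (p : ℤ) ∣ (d : ℤ) → {i : ℕ | (p : ℤ) ∣ P i}.Infinite) :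
    ∃ h : ↥(Sol1 P) → ↥(Sol1 Q), Continuous h ∧ (∀ x y, h (x + y) = h x + h y) ∧
      ∀ s : ℝ, h (sol1Pi P hP s) = sol1Pi Q hQ ((c : ℝ) / (d : ℝ) * s) := by
  have key : ∀ i, ∃ n, ∃ k : ℤ, ∏ j ∈ Finset.range n, P j
      = (d : ℤ) * (∏ j ∈ Finset.range i, Q j) * k := fun i => by
    obtain ⟨n, hn⟩ := exists_mul_prod_range_dvd P hd.ne'
      (fun p hp hpd => hdP p hp (Int.natCast_dvd_natCast.mpr hpd)) i
    exact ⟨n, (mul_dvd_mul_left _ (hdvd i)).trans hn⟩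
  choose n k hnk using key
  refine ⟨fun x => ⟨fun i => (c * k i) • x.1 (n i), fun i => ?_⟩, ?_, ?_, ?_⟩
  · rw [← mul_smul]
    refine Sol1.zsmul_apply_eq hP x.2 ?_
    rw [hnk i, hnk (i + 1), Finset.prod_range_succ]
    ring
  · refine Continuous.subtype_mk (continuous_pi fun i => ?_) _
    exact ((continuous_apply (n i)).comp continuous_subtype_val).zsmul _
  · intro x y
    ext i
    exact smul_add _ _ _
  · intro s
    ext i
    have hA : (∏ j ∈ Finset.range (n i), P j) ≠ 0 := Finset.prod_ne_zero_iff.mpr fun j _ => hP j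
    rw [hnk i] at hA
    have hk : (k i : ℝ) ≠ 0 := Int.cast_ne_zero.mpr (right_ne_zero_of_mul hA)
    have hB : ((∏ j ∈ Finset.range i, Q j : ℤ) : ℝ) ≠ 0 :=
      Int.cast_ne_zero.mpr (right_ne_zero_of_mul (left_ne_zero_of_mul hA))
    have hd' : (d : ℝ) ≠ 0 := Nat.cast_ne_zero.mpr hd.ne'
    change (c * k i) • ((sol1PiVec P s (n i) : ℝ) : AddCircle (1 : ℝ))
      = ((sol1PiVec Q ((c : ℝ) / (d : ℝ) * s) i : ℝ) : AddCircle (1 : ℝ))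
    rw [← AddCircle.coe_zsmul, sol1PiVec_eq_div_prod, sol1PiVec_eq_div_prod, hnk i, zsmul_eq_mul]
    congr 1
    simp only [Int.cast_mul, Int.cast_natCast]
    field_simp

end
end

section
/- Let P = (p₁, p₂, …) and Q = (q₁, q₂, …) be sequences of nonzero integers and let c, d be nonzero integers. Suppose there exists an N such that q₁⋯q_N does not divide c·p₁⋯p_m for any m. Then there is no continuous function h : C_P → Σ_Q (C_P carrying the subspace topology from Σ_P) such that h(π_P(s)) = π_Q((c/d)·s) for all s ∈ ℝ. In particular, if P is strictly below Q or P and Q are not comparable, no nonzero rational number is a proper P → Q multiplier. -/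
noncomputable section

theorem sol1PiVec_eq_div (P : ℕ → ℤ) (t : ℝ) (j : ℕ) :
    sol1PiVec P t j = t / ((∏ i ∈ Finset.range j, P i : ℤ) : ℝ) := by
  induction j with
  | zero => simp [sol1PiVec]
  | succ j ih => simp [sol1PiVec, ih, Finset.prod_range_succ, div_div]

theorem sol1Pi_apply (P : ℕ → ℤ) (hP : ∀ j, P j ≠ 0) (t : ℝ) (j : ℕ) :
    (sol1Pi P hP t : ℕ → AddCircle (1 : ℝ)) j =
      ((t / ((∏ i ∈ Finset.range j, P i : ℤ) : ℝ) : ℝ) : AddCircle (1 : ℝ)) :=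
  congrArg _ (sol1PiVec_eq_div P t j)

theorem sol1Pi_zero (P : ℕ → ℤ) (hP : ∀ j, P j ≠ 0) : sol1Pi P hP 0 = 0 := by
  ext j
  simp [sol1Pi_apply]

theorem continuous_sol1Pi (P : ℕ → ℤ) (hP : ∀ j, P j ≠ 0) : Continuous (sol1Pi P hP) := by
  refine Continuous.subtype_mk (continuous_pi fun j => ?_) _
  simp only [sol1PiVec_eq_div]
  exact (AddCircle.continuous_mk' 1).comp (continuous_id.div_const _)

theorem sol1Pi_mem_pathComponent (P : ℕ → ℤ) (hP : ∀ j, P j ≠ 0) (t : ℝ) :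
    sol1Pi P hP t ∈ pathComponent (0 : ↥(Sol1 P)) := by
  have h := (PathConnectedSpace.joined (0 : ℝ) t).map (continuous_sol1Pi P hP)
  rwa [sol1Pi_zero] at h

theorem coe_intCast_div_eq_zero_iff {a b : ℤ} (hb : b ≠ 0) :
    (((a : ℝ) / (b : ℝ) : ℝ) : AddCircle (1 : ℝ)) = 0 ↔ b ∣ a := by
  have hb' : (b : ℝ) ≠ 0 := by exact_mod_cast hb
  rw [AddCircle.coe_eq_zero_iff]
  constructor
  · rintro ⟨n, hn⟩
    refine ⟨n, ?_⟩
    rw [zsmul_one, eq_div_iff hb'] at hn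
    rw [mul_comm]
    exact_mod_cast hn.symm
  · rintro ⟨n, rfl⟩
    refine ⟨n, ?_⟩
    rw [zsmul_one]
    push_cast
    field_simp

/-- The points `π_P (d * p₁⋯p_m)` converge to the identity of `Σ_P`. -/
theorem tendsto_sol1Pi_mul_prod (P : ℕ → ℤ) (hP : ∀ j, P j ≠ 0) (d : ℤ) :
    Filter.Tendsto
      (fun m : ℕ => sol1Pi P hP ((d * ∏ i ∈ Finset.range m, P i : ℤ) : ℝ))
      Filter.atTop (nhds 0) := by
  rw [tendsto_subtype_rng, tendsto_pi_nhds]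
  intro j
  refine tendsto_const_nhds.congr' ?_
  filter_upwards [Filter.eventually_ge_atTop j] with m hm
  rw [sol1Pi_apply, eq_comm]
  refine (coe_intCast_div_eq_zero_iff (Finset.prod_ne_zero_iff.2 fun i _ => hP i)).2 ?_
  exact (Finset.prod_dvd_prod_of_subset _ _ _ (Finset.range_mono hm)).mul_left d

/-- A sequence of fractions with a fixed denominator converging to `0` modulo `1` is
eventually integral. -/
theorem eventually_dvd_of_tendsto_div {b : ℤ} (hb : b ≠ 0) {a : ℕ → ℤ}
    (ha : Filter.Tendsto (fun m => (((a m : ℝ) / (b : ℝ) : ℝ) : AddCircle (1 : ℝ)))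
      Filter.atTop (nhds 0)) :
    ∀ᶠ m in Filter.atTop, b ∣ a m := by
  have hb' : (0 : ℝ) < |(b : ℝ)| := by positivity
  have hsmall := (tendsto_zero_iff_norm_tendsto_zero.1 ha).eventually_lt_const
    (inv_pos.2 hb')
  filter_upwards [hsmall] with m hm
  rw [UnitAddCircle.norm_eq] at hm
  set r := round ((a m : ℝ) / (b : ℝ))
  have hlt : |(a m - b * r : ℤ)| < 1 := by
    have hb0 : (b : ℝ) ≠ 0 := by exact_mod_cast hb
    have := mul_lt_mul_of_pos_left hm hb'
    rw [← abs_mul, mul_sub, mul_div_cancel₀ _ hb0, mul_inv_cancel₀ hb'.ne'] at this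
    exact_mod_cast this
  exact ⟨r, sub_eq_zero.1 (Int.abs_lt_one_iff.1 hlt)⟩

/-- If for some `N` the product `q₁⋯q_N` divides `c·p₁⋯p_m` for no `m`, then there is
no continuous map `h` from the path component `C_P` of the identity in `Σ_P` to `Σ_Q`
with `h (π_P s) = π_Q ((c/d) s)` for all `s ∈ ℝ`. -/
theorem sol1_incomparable_multiplier_not_continuous (P Q : ℕ → ℤ)
    (hP : ∀ j, P j ≠ 0) (hQ : ∀ j, Q j ≠ 0) (c d : ℤ) (hc : c ≠ 0) (hd : d ≠ 0)
    (hN : ∃ N : ℕ, ∀ m : ℕ,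
      ¬ (∏ j ∈ Finset.range N, Q j) ∣ c * ∏ j ∈ Finset.range m, P j) :
    ¬ ∃ h : ↥(Sol1 P) → ↥(Sol1 Q),
        ContinuousOn h (pathComponent (0 : ↥(Sol1 P))) ∧
        ∀ s : ℝ, h (sol1Pi P hP s) = sol1Pi Q hQ ((c : ℝ) / (d : ℝ) * s) := by
  rintro ⟨h, hcont, hmul⟩
  obtain ⟨N, hN⟩ := hN
  have hd' : (d : ℝ) ≠ 0 := by exact_mod_cast hd
  have h0 : h 0 = 0 := by
    have := hmul 0
    rwa [mul_zero, sol1Pi_zero, sol1Pi_zero] at this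
  have hlim := (hcont 0 (mem_pathComponent_self 0)).tendsto.comp
    (tendsto_nhdsWithin_iff.2 ⟨tendsto_sol1Pi_mul_prod P hP d,
      Filter.Eventually.of_forall fun _ => sol1Pi_mem_pathComponent P hP _⟩)
  rw [h0, tendsto_subtype_rng, tendsto_pi_nhds] at hlim
  have hdvd := eventually_dvd_of_tendsto_div
    (b := ∏ i ∈ Finset.range N, Q i) (a := fun m => c * ∏ i ∈ Finset.range m, P i)
    (Finset.prod_ne_zero_iff.2 fun i _ => hQ i) ((hlim N).congr fun m => by
      rw [Function.comp_apply, hmul, sol1Pi_apply]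
      congr 2
      push_cast
      field_simp)
  obtain ⟨m, hm⟩ := hdvd.exists
  exact hN m hm

end
end
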